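/- Let A, X ∈ ℂ^{n₁×n₁×n₃} be third-order tensors and ind(A) = k. Then X is a GD inverse of A (i.e., A ⋆ X ⋆ A = A, X ⋆ A^{k+1} = A^k, and A^{k+1} ⋆ X = A^k) if and only if A ⋆ X ⋆ A = A and A^k ⋆ X = X ⋆ A^k. -/

import Mathlib

open Matrix BigOperators

/-- A third-order complex tensor in `ℂ^{n₁ × n₂ × n₃}`, given by its frontal slices. -/
abbrev Tensor3 (n₁ n₂ n₃ : ℕ) := Fin n₃ → Matrix (Fin n₁) (Fin n₂) ℂ

/-- Mode-3 product of a tensor with an `n₃ × n₃` matrix: the slices of the result are the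
indicated linear combinations of the slices of `A`. -/
noncomputable def mode3 {n₁ n₂ n₃ : ℕ} (M : Matrix (Fin n₃) (Fin n₃) ℂ) (A : Tensor3 n₁ n₂ n₃) :
    Tensor3 n₁ n₂ n₃ :=
  fun i => ∑ j, M i j • A j

/-- The M-product `A ⋆_M B`: slice-wise matrix product in the transformed (hat) domain,
transformed back by `M⁻¹`. -/
noncomputable def mprod {n₁ n₂ l n₃ : ℕ} (M : Matrix (Fin n₃) (Fin n₃) ℂ)
    (A : Tensor3 n₁ n₂ n₃) (B : Tensor3 n₂ l n₃) : Tensor3 n₁ l n₃ :=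
  mode3 M⁻¹ (fun i => mode3 M A i * mode3 M B i)

/-- The identity tensor: every slice of its mode-3 transform is the identity matrix. -/
noncomputable def idT (n₁ : ℕ) {n₃ : ℕ} (M : Matrix (Fin n₃) (Fin n₃) ℂ) : Tensor3 n₁ n₁ n₃ :=
  mode3 M⁻¹ (fun _ => (1 : Matrix (Fin n₁) (Fin n₁) ℂ))

/-- Powers of a square tensor with respect to the M-product. -/
noncomputable def mpow {n₁ n₃ : ℕ} (M : Matrix (Fin n₃) (Fin n₃) ℂ) (A : Tensor3 n₁ n₁ n₃) :
    ℕ → Tensor3 n₁ n₁ n₃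
  | 0 => idT n₁ M
  | k + 1 => mprod M (mpow M A k) A

/-- Conjugate transpose with respect to the M-product: slice-wise conjugate transpose in the
transformed domain. -/
noncomputable def ctrans {n₁ n₂ n₃ : ℕ} (M : Matrix (Fin n₃) (Fin n₃) ℂ) (A : Tensor3 n₁ n₂ n₃) :
    Tensor3 n₂ n₁ n₃ :=
  mode3 M⁻¹ (fun i => (mode3 M A i)ᴴ)

/-- Index of a square complex matrix: the least `k ≥ 0` with `rank(B^k) = rank(B^{k+1})`. -/
noncomputable def matIndex {n : ℕ} (B : Matrix (Fin n) (Fin n) ℂ) : ℕ :=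
  sInf {k : ℕ | (B ^ k).rank = (B ^ (k + 1)).rank}

/-- Index of a tensor: the maximum of the indices of the slices of its mode-3 transform. -/
noncomputable def tIndex {n₁ n₃ : ℕ} (M : Matrix (Fin n₃) (Fin n₃) ℂ)
    (A : Tensor3 n₁ n₁ n₃) : ℕ :=
  Finset.univ.sup fun i => matIndex (mode3 M A i)

/-- `X` is a GD inverse of `A` with exponent `k`:
`A ⋆ X ⋆ A = A`, `X ⋆ A^{k+1} = A^k`, `A^{k+1} ⋆ X = A^k`. -/
def IsGD {n₁ n₃ : ℕ} (M : Matrix (Fin n₃) (Fin n₃) ℂ) (A X : Tensor3 n₁ n₁ n₃)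
    (k : ℕ) : Prop :=
  mprod M (mprod M A X) A = A ∧
  mprod M X (mpow M A (k + 1)) = mpow M A k ∧
  mprod M (mpow M A (k + 1)) X = mpow M A k

/-- `X` is the Drazin inverse of `A` with exponent `k`. -/
def IsDrazin {n₁ n₃ : ℕ} (M : Matrix (Fin n₃) (Fin n₃) ℂ) (A X : Tensor3 n₁ n₁ n₃)
    (k : ℕ) : Prop :=
  mprod M X (mpow M A (k + 1)) = mpow M A k ∧
  mprod M (mprod M X A) X = X ∧
  mprod M X A = mprod M A X

/-- `X` is the Moore–Penrose inverse of `A`. -/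
def IsMP {n₁ n₃ : ℕ} (M : Matrix (Fin n₃) (Fin n₃) ℂ) (A X : Tensor3 n₁ n₁ n₃) : Prop :=
  mprod M (mprod M A X) A = A ∧
  mprod M (mprod M X A) X = X ∧
  ctrans M (mprod M A X) = mprod M A X ∧
  ctrans M (mprod M X A) = mprod M X A

theorem mode3_mode3 {n₁ n₂ n₃ : ℕ} (M N : Matrix (Fin n₃) (Fin n₃) ℂ) (A : Tensor3 n₁ n₂ n₃) :
    mode3 M (mode3 N A) = mode3 (M * N) A := by
  funext i
  simp only [mode3, Finset.smul_sum, smul_smul, Matrix.mul_apply, Finset.sum_smul]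
  exact Finset.sum_comm

theorem mode3_one {n₁ n₂ n₃ : ℕ} (A : Tensor3 n₁ n₂ n₃) : mode3 1 A = A := by
  funext i
  simp [mode3, Matrix.one_apply]

theorem mode3_mode3_inv {n₁ n₂ n₃ : ℕ} {M : Matrix (Fin n₃) (Fin n₃) ℂ} (hM : IsUnit M)
    (A : Tensor3 n₁ n₂ n₃) : mode3 M (mode3 M⁻¹ A) = A := by
  rw [mode3_mode3, Matrix.mul_nonsing_inv M ((Matrix.isUnit_iff_isUnit_det M).1 hM), mode3_one]

theorem mode3_injective {n₁ n₂ n₃ : ℕ} {M : Matrix (Fin n₃) (Fin n₃) ℂ} (hM : IsUnit M) :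
    Function.Injective (mode3 M : Tensor3 n₁ n₂ n₃ → Tensor3 n₁ n₂ n₃) := by
  refine Function.LeftInverse.injective (g := mode3 M⁻¹) fun A => ?_
  rw [mode3_mode3, Matrix.nonsing_inv_mul M ((Matrix.isUnit_iff_isUnit_det M).1 hM), mode3_one]

theorem mode3_mprod {n₁ n₂ l n₃ : ℕ} {M : Matrix (Fin n₃) (Fin n₃) ℂ} (hM : IsUnit M)
    (A : Tensor3 n₁ n₂ n₃) (B : Tensor3 n₂ l n₃) (i : Fin n₃) :
    mode3 M (mprod M A B) i = mode3 M A i * mode3 M B i := by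
  rw [mprod, mode3_mode3_inv hM]

theorem mode3_mpow {n₁ n₃ : ℕ} {M : Matrix (Fin n₃) (Fin n₃) ℂ} (hM : IsUnit M)
    (A : Tensor3 n₁ n₁ n₃) (k : ℕ) (i : Fin n₃) : mode3 M (mpow M A k) i = mode3 M A i ^ k := by
  induction k with
  | zero => rw [mpow, idT, mode3_mode3_inv hM, pow_zero]
  | succ k ih => rw [mpow, mode3_mprod hM, ih, pow_succ]

theorem tensor_eq_iff {n₁ n₂ n₃ : ℕ} {M : Matrix (Fin n₃) (Fin n₃) ℂ} (hM : IsUnit M)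
    {A B : Tensor3 n₁ n₂ n₃} : A = B ↔ ∀ i, mode3 M A i = mode3 M B i := by
  rw [← (mode3_injective hM).eq_iff, funext_iff]

theorem rank_pow_matIndex {n : ℕ} (B : Matrix (Fin n) (Fin n) ℂ) :
    (B ^ matIndex B).rank = (B ^ (matIndex B + 1)).rank := by
  refine Nat.sInf_mem (s := {k : ℕ | (B ^ k).rank = (B ^ (k + 1)).rank})
    ⟨Function.argmin fun k : ℕ => (B ^ k).rank, le_antisymm
      (Function.argmin_le (fun k : ℕ => (B ^ k).rank) _) ?_⟩
  rw [pow_succ]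
  exact Matrix.rank_mul_le_left _ _

theorem isUnit_of_matIndex_eq_zero {n : ℕ} {B : Matrix (Fin n) (Fin n) ℂ}
    (h : matIndex B = 0) : IsUnit B := by
  have hr := rank_pow_matIndex B
  rw [h, zero_add, pow_zero, pow_one, Matrix.rank_one] at hr
  refine Matrix.mulVec_surjective_iff_isUnit.1 (LinearMap.range_eq_top (f := B.mulVecLin).1 ?_)
  refine Submodule.eq_top_of_finrank_eq ?_
  rw [Module.finrank_fin_fun]
  simpa [Matrix.rank] using hr.symm

theorem mul_pow_succ_and_pow_succ_mul_iff_commute {R : Type*} [Monoid R] {a x : R} {k : ℕ}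
    (hx : a * x * a = a) (hk : k = 0 → IsUnit a) :
    (x * a ^ (k + 1) = a ^ k ∧ a ^ (k + 1) * x = a ^ k) ↔ a ^ k * x = x * a ^ k := by
  constructor
  · rintro ⟨h₁, h₂⟩
    calc a ^ k * x = x * (a ^ (k + 1) * x) := by rw [← mul_assoc, h₁]
      _ = x * a ^ k := by rw [h₂]
  · intro h
    cases k with
    | zero =>
      have ha := hk rfl
      have h₁ : a * x = 1 := ha.mul_right_cancel (by rw [hx, one_mul])
      have h₂ : x * a = 1 := ha.mul_left_cancel (by rw [← mul_assoc, hx, mul_one])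
      simp [h₁, h₂]
    | succ m =>
      constructor
      · calc x * a ^ (m + 1 + 1) = a ^ (m + 1) * x * a := by rw [pow_succ, ← mul_assoc, h]
          _ = a ^ m * (a * x * a) := by simp only [pow_succ, mul_assoc]
          _ = a ^ (m + 1) := by rw [hx, pow_succ]
      · calc a ^ (m + 1 + 1) * x = a * (x * a ^ (m + 1)) := by rw [pow_succ', mul_assoc, h]
          _ = a * x * a * a ^ m := by simp only [pow_succ', mul_assoc]
          _ = a ^ (m + 1) := by rw [hx, pow_succ']

/-- `X` is a GD inverse of `A` (with `k = ind(A)`) iff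
`A ⋆ X ⋆ A = A` and `A^k ⋆ X = X ⋆ A^k`. -/
theorem gd_iff_commutes_with_power {n₁ n₃ : ℕ} (hn₁ : 0 < n₁) (hn₃ : 0 < n₃)
    (M : Matrix (Fin n₃) (Fin n₃) ℂ) (hM : IsUnit M)
    (A X : Tensor3 n₁ n₁ n₃) (k : ℕ) (hk : tIndex M A = k) :
    IsGD M A X k ↔
      (mprod M (mprod M A X) A = A ∧
        mprod M (mpow M A k) X = mprod M X (mpow M A k)) := by
  have hunit (i : Fin n₃) (h0 : k = 0) : IsUnit (mode3 M A i) :=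
    isUnit_of_matIndex_eq_zero <| Nat.le_zero.1 <|
      (Finset.le_sup (f := fun i => matIndex (mode3 M A i)) (Finset.mem_univ i)).trans
        (hk.trans h0).le
  refine and_congr_right fun hX => ?_
  simp only [tensor_eq_iff hM, mode3_mprod hM, mode3_mpow hM] at hX ⊢
  rw [← forall_and]
  exact forall_congr' fun i => mul_pow_succ_and_pow_succ_mul_iff_commute (hX i) (hunit i)
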